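/- For all integers n ≥ 1 and 1 ≤ h ≤ n and all reals a, y > 0, one has a · (b_{n,h})⁴ · y^{4h} ≤ P^C_{4n}(a, y²) and a · (b_{n,h})⁴ · y^{4h} ≤ P^C_{4n+2}(a, y²). -/

import Mathlib

open Finset Filter

attribute [local instance] Classical.propDecidable

/-- Height (second coordinate) of a binomial path after `i` steps, starting at height `c`;
steps are encoded by `s : Fin n → Bool` (`true` = up step `(1,1)`, `false` = down step `(1,-1)`).
The path visits the points `(x₀ + i, hgt c s i)` for `0 ≤ i ≤ n`. -/
def hgt {n : ℕ} (c : ℤ) (s : Fin n → Bool) (i : ℕ) : ℤ :=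
  c + ∑ j ∈ Finset.range i, (if h : j < n then (if s ⟨j, h⟩ then (1 : ℤ) else -1) else 0)

/-- The path lies in the upper half-plane (all second coordinates ≥ 0). -/
def InUHP {n : ℕ} (c : ℤ) (s : Fin n → Bool) : Prop :=
  ∀ i ≤ n, 0 ≤ hgt c s i

/-- The number of vertices of the path with second coordinate 0. -/
def visits {n : ℕ} (c : ℤ) (s : Fin n → Bool) : ℕ :=
  ((Finset.range (n + 1)).filter (fun i => hgt c s i = 0)).card

/-- `b_{n,h}`: the number of bridges of length `n` and height `h`, i.e. binomial paths
starting at `(0,0)` whose second coordinates satisfy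
`0 = y(ω₀) < y(ωᵢ) ≤ y(ωₙ) = h` for all `1 ≤ i ≤ n-1`. -/
noncomputable def bridgeCount (n h : ℕ) : ℕ :=
  ((Finset.univ : Finset (Fin n → Bool)).filter
    (fun s => hgt 0 s n = (h : ℤ) ∧
      ∀ i, 1 ≤ i → i ≤ n - 1 → 0 < hgt 0 s i ∧ hgt 0 s i ≤ (h : ℤ))).card

/-- `(c, sp, sm)` encodes a staircase polygon of length `2n` in `𝒫^S_{2n}`:
both binomial paths of length `n` start at `(0, c)` (so the leftmost vertex has first
coordinate `0`), they end at the same point, the upper path `sp` is strictly above the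
lower path `sm` at the intermediate points, the polygon lies in the upper half-plane,
and it has at least one vertex with second coordinate `0`. -/
def IsStaircase {n : ℕ} (c : ℤ) (sp sm : Fin n → Bool) : Prop :=
  hgt c sp n = hgt c sm n ∧
  (∀ i, 0 < i → i < n → hgt c sm i < hgt c sp i) ∧
  InUHP c sp ∧ InUHP c sm ∧
  (∃ i ≤ n, hgt c sp i = 0 ∨ hgt c sm i = 0)

/-- `P^C_{2n}(a,y)`: partition function of centred staircase polygons of length `2n`,
i.e. those with `π⁻_{⌊n/2⌋}` having second coordinate `0`. -/
noncomputable def PC (n : ℕ) (a y : ℝ) : ℝ :=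
  ∑ p ∈ (Finset.univ : Finset (Fin (n + 1) × (Fin n → Bool) × (Fin n → Bool))).filter
      (fun p => IsStaircase ((p.1 : ℕ) : ℤ) p.2.1 p.2.2 ∧
        hgt ((p.1 : ℕ) : ℤ) p.2.2 (n / 2) = 0),
    a ^ visits ((p.1 : ℕ) : ℤ) p.2.2 * y ^ hgt ((p.1 : ℕ) : ℤ) p.2.1 (n / 2)

/-- Upper path. -/
def upP (n d : ℕ) (b1 b2 : Fin n → Bool) : Fin (2 * n + d) → Bool := fun j =>
  if h1 : (j : ℕ) < n then b1 ⟨j, h1⟩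
  else if h2 : (j : ℕ) < n + d then true
  else !(b2 ⟨2 * n + d - 1 - j, by omega⟩)

/-- Lower path. -/
def loP (n d : ℕ) (b3 b4 : Fin n → Bool) : Fin (2 * n + d) → Bool := fun j =>
  if h1 : (j : ℕ) < n then !(b3 ⟨n - 1 - j, by omega⟩)
  else if h2 : (j : ℕ) < n + d then true
  else b4 ⟨j - n - d, by omega⟩

/-- The bridge property. -/
def IsBr (n h : ℕ) (s : Fin n → Bool) : Prop :=
  hgt 0 s n = (h : ℤ) ∧
      ∀ i, 1 ≤ i → i ≤ n - 1 → 0 < hgt 0 s i ∧ hgt 0 s i ≤ (h : ℤ)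

lemma hgt_zero {n : ℕ} (c : ℤ) (s : Fin n → Bool) : hgt c s 0 = c := by simp [hgt]

lemma hgt_succ {n : ℕ} (c : ℤ) (s : Fin n → Bool) (i : ℕ) (hi : i < n) :
    hgt c s (i + 1) = hgt c s i + (if s ⟨i, hi⟩ then (1 : ℤ) else -1) := by
  simp only [hgt, Finset.sum_range_succ, dif_pos hi]
  ring

lemma IsBr.bd {n h : ℕ} {s : Fin n → Bool} (H : IsBr n h s) (hh : 1 ≤ h) (i : ℕ) (h1 : 1 ≤ i)
    (h2 : i ≤ n) : 0 < hgt 0 s i ∧ hgt 0 s i ≤ (h : ℤ) := by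
  rcases Nat.lt_or_ge i n with h3 | h3
  · exact H.2 i h1 (by omega)
  · obtain rfl : i = n := by omega
    have := H.1
    omega

lemma up1 (n d : ℕ) (c : ℤ) (b1 b2 : Fin n → Bool) (i : ℕ) (hi : i ≤ n) :
    hgt c (upP n d b1 b2) i = c + hgt 0 b1 i := by
  induction i with
  | zero => simp [hgt_zero]
  | succ i ih =>
    rw [hgt_succ _ _ _ (by omega), hgt_succ _ _ _ (by omega : i < n), ih (by omega)]
    have : upP n d b1 b2 ⟨i, by omega⟩ = b1 ⟨i, by omega⟩ := by
      simp only [upP]; rw [dif_pos (by omega)]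
    rw [this]; ring

lemma lo1 (n h d : ℕ) (b3 b4 : Fin n → Bool) (H : IsBr n h b3) (i : ℕ) (hi : i ≤ n) :
    hgt h (loP n d b3 b4) i = hgt 0 b3 (n - i) := by
  induction i with
  | zero => simp [hgt_zero, H.1]
  | succ i ih =>
    rw [hgt_succ _ _ _ (by omega), ih (by omega)]
    have e : n - i = (n - 1 - i) + 1 := by omega
    have e' : n - (i + 1) = n - 1 - i := by omega
    rw [e, e', hgt_succ _ _ _ (by omega)]
    have : loP n d b3 b4 ⟨i, by omega⟩ = !(b3 ⟨n - 1 - i, by omega⟩) := by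
      simp only [loP]; rw [dif_pos (by omega)]
    rw [this]
    cases b3 ⟨n - 1 - i, by omega⟩ <;> simp

lemma up2 (n h d : ℕ) (b1 b2 : Fin n → Bool) (H : IsBr n h b1) (k : ℕ) (hk : k ≤ d) :
    hgt h (upP n d b1 b2) (n + k) = 2 * h + k := by
  induction k with
  | zero => simp only [add_zero]; rw [up1 _ _ _ _ _ _ le_rfl, H.1]; push_cast; ring
  | succ k ih =>
    rw [← add_assoc, hgt_succ _ _ _ (by omega), ih (by omega)]
    have : upP n d b1 b2 ⟨n + k, by omega⟩ = true := by
      simp only [upP]; rw [dif_neg (by omega), dif_pos (by omega)]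
    rw [this]; simp; ring

lemma lo2 (n h d : ℕ) (b3 b4 : Fin n → Bool) (H : IsBr n h b3) (k : ℕ) (hk : k ≤ d) :
    hgt h (loP n d b3 b4) (n + k) = k := by
  induction k with
  | zero => simp only [add_zero]; rw [lo1 _ _ _ _ _ H _ le_rfl]; simp [hgt_zero]
  | succ k ih =>
    rw [← add_assoc, hgt_succ _ _ _ (by omega), ih (by omega)]
    have : loP n d b3 b4 ⟨n + k, by omega⟩ = true := by
      simp only [loP]; rw [dif_neg (by omega), dif_pos (by omega)]
    rw [this]; simp

lemma up3 (n h d : ℕ) (b1 b2 : Fin n → Bool) (H : IsBr n h b1) (H2 : IsBr n h b2)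
    (k : ℕ) (hk : k ≤ n) :
    hgt h (upP n d b1 b2) (n + d + k) = h + d + hgt 0 b2 (n - k) := by
  induction k with
  | zero => simp only [add_zero, Nat.sub_zero]; rw [up2 _ _ _ _ _ H _ le_rfl, H2.1]; ring
  | succ k ih =>
    rw [← add_assoc, hgt_succ _ _ _ (by omega), ih (by omega)]
    have e : n - k = (n - 1 - k) + 1 := by omega
    have e' : n - (k + 1) = n - 1 - k := by omega
    rw [e, e', hgt_succ _ _ _ (by omega)]
    have : upP n d b1 b2 ⟨n + d + k, by omega⟩ = !(b2 ⟨n - 1 - k, by omega⟩) := by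
      simp only [upP]; rw [dif_neg (by omega), dif_neg (by omega)]
      congr 3; omega
    rw [this]
    cases b2 ⟨n - 1 - k, by omega⟩ <;> simp <;> ring

lemma lo3 (n h d : ℕ) (b3 b4 : Fin n → Bool) (H : IsBr n h b3)
    (k : ℕ) (hk : k ≤ n) :
    hgt h (loP n d b3 b4) (n + d + k) = d + hgt 0 b4 k := by
  induction k with
  | zero => simp only [add_zero]; rw [lo2 _ _ _ _ _ H _ le_rfl, hgt_zero]; ring
  | succ k ih =>
    rw [← add_assoc, hgt_succ _ _ _ (by omega), ih (by omega), hgt_succ _ _ _ (by omega : k < n)]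
    have : loP n d b3 b4 ⟨n + d + k, by omega⟩ = b4 ⟨k, by omega⟩ := by
      simp only [loP]; rw [dif_neg (by omega), dif_neg (by omega)]
      congr 2; omega
    rw [this]; ring

lemma up_inj (n d : ℕ) (b1 b2 b1' b2' : Fin n → Bool) (H : upP n d b1 b2 = upP n d b1' b2') :
    b1 = b1' ∧ b2 = b2' := by
  constructor
  · funext j
    have := congrFun H ⟨j, by omega⟩
    simpa [upP, j.2] using this
  · funext j
    have h := congrFun H ⟨2 * n + d - 1 - j, by omega⟩
    simp only [upP] at h
    rw [dif_neg (by omega), dif_neg (by omega), dif_neg (by omega), dif_neg (by omega)] at h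
    have e : (⟨2 * n + d - 1 - (2 * n + d - 1 - j), by omega⟩ : Fin n) = j := by
      ext; simp only; omega
    rw [e] at h
    simpa using h

lemma lo_inj (n d : ℕ) (b1 b2 b1' b2' : Fin n → Bool) (H : loP n d b1 b2 = loP n d b1' b2') :
    b1 = b1' ∧ b2 = b2' := by
  constructor
  · funext j
    have h := congrFun H ⟨n - 1 - j, by omega⟩
    simp only [loP] at h
    rw [dif_pos (by omega), dif_pos (by omega)] at h
    have e : (⟨n - 1 - (n - 1 - j), by omega⟩ : Fin n) = j := by
      ext; simp only; omega
    rw [e] at h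
    simpa using h
  · funext j
    have h := congrFun H ⟨n + d + j, by omega⟩
    simp only [loP] at h
    rw [dif_neg (by omega), dif_neg (by omega), dif_neg (by omega), dif_neg (by omega)] at h
    have e : (⟨n + d + j - n - d, by omega⟩ : Fin n) = j := by
      ext; simp only; omega
    rwa [e] at h

section
variable (n h d : ℕ) (hn : 1 ≤ n) (hh1 : 1 ≤ h) (b1 b2 b3 b4 : Fin n → Bool)
  (H1 : IsBr n h b1) (H2 : IsBr n h b2) (H3 : IsBr n h b3) (H4 : IsBr n h b4)

lemma lo_sign (hh1 : 1 ≤ h) (H3 : IsBr n h b3) (H4 : IsBr n h b4) (i : ℕ) (hi : i ≤ 2 * n + d) :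
    (i = n ∧ hgt h (loP n d b3 b4) i = 0) ∨ (i ≠ n ∧ 0 < hgt h (loP n d b3 b4) i) := by
  rcases lt_or_ge i n with h1 | h1
  · right
    rw [lo1 _ _ _ _ _ H3 _ h1.le]
    exact ⟨by omega, (H3.bd hh1 (n - i) (by omega) (by omega)).1⟩
  · obtain ⟨k, rfl⟩ := Nat.exists_eq_add_of_le h1
    rcases le_or_gt k d with h2 | h2
    · rw [lo2 _ _ _ _ _ H3 _ h2]; omega
    · obtain ⟨m, rfl⟩ := Nat.exists_eq_add_of_le h2.le
      rw [← add_assoc, lo3 _ _ _ _ _ H3 _ (by omega)]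
      have := (H4.bd hh1 m (by omega) (by omega)).1
      omega

lemma lo_lt_up (hh1 : 1 ≤ h) (H1 : IsBr n h b1) (H2 : IsBr n h b2) (H3 : IsBr n h b3)
    (H4 : IsBr n h b4) (i : ℕ) (hi0 : 0 < i) (hi : i < 2 * n + d) :
    hgt h (loP n d b3 b4) i < hgt h (upP n d b1 b2) i := by
  rcases lt_or_ge i n with h1 | h1
  · rw [lo1 _ _ _ _ _ H3 _ h1.le, up1 _ _ _ _ _ _ h1.le]
    have h2 := H3.bd hh1 (n - i) (by omega) (by omega)
    have h3 := H1.bd hh1 i (by omega) (by omega)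
    omega
  · obtain ⟨k, rfl⟩ := Nat.exists_eq_add_of_le h1
    rcases le_or_gt k d with h2 | h2
    · rw [lo2 _ _ _ _ _ H3 _ h2, up2 _ _ _ _ _ H1 _ h2]; omega
    · obtain ⟨m, rfl⟩ := Nat.exists_eq_add_of_le h2.le
      rw [← add_assoc, lo3 _ _ _ _ _ H3 _ (by omega), up3 _ _ _ _ _ H1 H2 _ (by omega)]
      have h5 := H4.bd hh1 m (by omega) (by omega)
      have h3 := H2.bd hh1 (n - m) (by omega) (by omega)
      omega

lemma ends (H1 : IsBr n h b1) (H2 : IsBr n h b2) (H3 : IsBr n h b3)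
    (H4 : IsBr n h b4) :
    hgt h (upP n d b1 b2) (2 * n + d) = hgt h (loP n d b3 b4) (2 * n + d) := by
  have e : 2 * n + d = n + d + n := by omega
  have h1 := lo3 n h d b3 b4 H3 n le_rfl
  have h2 := up3 n h d b1 b2 H1 H2 n le_rfl
  rw [← e] at h1 h2
  rw [h1, h2, H4.1, Nat.sub_self, hgt_zero]; ring

lemma stair (hn : 1 ≤ n) (hh1 : 1 ≤ h) (H1 : IsBr n h b1) (H2 : IsBr n h b2) (H3 : IsBr n h b3)
    (H4 : IsBr n h b4) :
    IsStaircase (h : ℤ) (upP n d b1 b2) (loP n d b3 b4) := by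
  have hlo : InUHP (h : ℤ) (loP n d b3 b4) := by
    intro i hi
    rcases lo_sign n h d b3 b4 hh1 H3 H4 i hi with h1 | h1 <;> omega
  have hE := ends n h d b1 b2 b3 b4 H1 H2 H3 H4
  refine ⟨hE, lo_lt_up n h d b1 b2 b3 b4 hh1 H1 H2 H3 H4, ?_, hlo, n, by omega, Or.inr ?_⟩
  · intro i hi
    have h0 := hlo i hi
    rcases Nat.eq_zero_or_pos i with rfl | h1
    · rw [hgt_zero]; omega
    · rcases hi.lt_or_eq with h2 | h2
      · have := lo_lt_up n h d b1 b2 b3 b4 hh1 H1 H2 H3 H4 i h1 h2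
        omega
      · rw [h2] at h0 ⊢
        rw [hE]; exact h0
  · simpa using lo2 n h d b3 b4 H3 0 (by omega)

lemma vis (hh1 : 1 ≤ h) (H3 : IsBr n h b3) (H4 : IsBr n h b4) :
    visits (h : ℤ) (loP n d b3 b4) = 1 := by
  unfold visits
  rw [Finset.card_eq_one]
  refine ⟨n, ?_⟩
  ext i
  simp only [Finset.mem_filter, Finset.mem_range, Finset.mem_singleton]
  constructor
  · rintro ⟨hi, h0⟩
    rcases lo_sign n h d b3 b4 hh1 H3 H4 i (by omega) with h1 | h1 <;> omega
  · rintro rfl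
    exact ⟨by omega, by simpa using lo2 i h d b3 b4 H3 0 (by omega)⟩
end

lemma main_lb (n h d : ℕ) (hd : d ≤ 1) (hn : 1 ≤ n) (hh1 : 1 ≤ h) (hhn : h ≤ n)
    (a y : ℝ) (ha : 0 < a) (hy : 0 < y) :
    a * (bridgeCount n h : ℝ) ^ 4 * y ^ (4 * h) ≤ PC (2 * n + d) a (y ^ 2) := by
  have hN : (2 * n + d) / 2 = n := by omega
  unfold PC
  rw [hN]
  set B : Finset (Fin n → Bool) := (Finset.univ : Finset (Fin n → Bool)).filter
    (fun s => hgt 0 s n = (h : ℤ) ∧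
      ∀ i, 1 ≤ i → i ≤ n - 1 → 0 < hgt 0 s i ∧ hgt 0 s i ≤ (h : ℤ)) with hB
  have hBm : ∀ s ∈ B, IsBr n h s := fun s hs => by
    simp only [hB, Finset.mem_filter] at hs
    exact hs.2
  have hc : bridgeCount n h = B.card := rfl
  let f : ((Fin n → Bool) × (Fin n → Bool)) × ((Fin n → Bool) × (Fin n → Bool)) →
      Fin (2 * n + d + 1) × (Fin (2 * n + d) → Bool) × (Fin (2 * n + d) → Bool) :=
    fun q => (⟨h, by omega⟩, upP n d q.1.1 q.1.2, loP n d q.2.1 q.2.2)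
  have hf : Function.Injective f := by
    rintro ⟨⟨q1, q2⟩, q3, q4⟩ ⟨⟨r1, r2⟩, r3, r4⟩ hqr
    simp only [f, Prod.mk.injEq, true_and] at hqr
    obtain ⟨rfl, rfl⟩ := up_inj _ _ _ _ _ _ hqr.1
    obtain ⟨rfl, rfl⟩ := lo_inj _ _ _ _ _ _ hqr.2
    rfl
  let S := (B ×ˢ B) ×ˢ (B ×ˢ B)
  calc a * (bridgeCount n h : ℝ) ^ 4 * y ^ (4 * h)
      = ∑ q ∈ S, a * y ^ (4 * h) := by
        rw [Finset.sum_const, nsmul_eq_mul]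
        simp only [S, Finset.card_product, hc]
        push_cast; ring
    _ = ∑ q ∈ S, a ^ visits (((f q).1 : ℕ) : ℤ) (f q).2.2 *
          (y ^ 2) ^ hgt (((f q).1 : ℕ) : ℤ) (f q).2.1 n := by
        refine Finset.sum_congr rfl ?_
        rintro ⟨⟨q1, q2⟩, q3, q4⟩ hq
        simp only [S, Finset.mem_product] at hq
        obtain ⟨⟨h1, h2⟩, h3, h4⟩ := hq
        simp only [f]
        rw [vis n h d q3 q4 hh1 (hBm _ h3) (hBm _ h4), pow_one]
        have := up2 n h d q1 q2 (hBm _ h1) 0 (by omega)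
        simp only [add_zero] at this
        rw [this]
        have e : (2 * (h : ℤ) + ((0 : ℕ) : ℤ)) = ((2 * h : ℕ) : ℤ) := by push_cast; ring
        rw [e, zpow_natCast, ← pow_mul]
        congr 2; ring
    _ = ∑ p ∈ S.image f, a ^ visits ((p.1 : ℕ) : ℤ) p.2.2 *
          (y ^ 2) ^ hgt ((p.1 : ℕ) : ℤ) p.2.1 n := by
        rw [Finset.sum_image (fun _ _ _ _ hx => hf hx)]
    _ ≤ _ := by
        refine Finset.sum_le_sum_of_subset_of_nonneg ?_ (fun p _ _ => by positivity)
        intro p hp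
        obtain ⟨⟨⟨q1, q2⟩, q3, q4⟩, hq, rfl⟩ := Finset.mem_image.1 hp
        simp only [S, Finset.mem_product] at hq
        obtain ⟨⟨h1, h2⟩, h3, h4⟩ := hq
        refine Finset.mem_filter.2 ⟨Finset.mem_univ _, ?_, ?_⟩
        · exact stair n h d q1 q2 q3 q4 hn hh1 (hBm _ h1) (hBm _ h2) (hBm _ h3) (hBm _ h4)
        · simpa using lo2 n h d q3 q4 (hBm _ h3) 0 (by omega)

/-- Four bridges of length `n` and height `h` concatenate to give centred polygons:
`a ⬝ (b_{n,h})⁴ y^{4h} ≤ P^C_{4n}(a, y²)` and `a ⬝ (b_{n,h})⁴ y^{4h} ≤ P^C_{4n+2}(a, y²)`.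
(Here `PC N` denotes `P^C_{2N}`, so `P^C_{4n} = PC (2n)` and `P^C_{4n+2} = PC (2n+1)`.) -/
theorem bridges_lb (n h : ℕ) (hn : 1 ≤ n) (hh1 : 1 ≤ h) (hhn : h ≤ n)
    (a y : ℝ) (ha : 0 < a) (hy : 0 < y) :
    a * (bridgeCount n h : ℝ) ^ 4 * y ^ (4 * h) ≤ PC (2 * n) a (y ^ 2) ∧
    a * (bridgeCount n h : ℝ) ^ 4 * y ^ (4 * h) ≤ PC (2 * n + 1) a (y ^ 2) := by
  exact ⟨main_lb n h 0 (by omega) hn hh1 hhn a y ha hy,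
    main_lb n h 1 (by omega) hn hh1 hhn a y ha hy⟩
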